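/- Let S ≥ 2 be an integer and F(u)=(1−u²)₊^S. For every Y > 1 there exists an even Schwartz function H_Y whose Fourier transform vanishes for |x| ≥ Y, such that for k = 0,1,…,S−1 and all u ∈ ℝ, |F^{(k)}(u) − H_Y^{(k)}(u)| ≤ c·Y^{k−S}, and for every integer N ≥ 1 and |u| ≥ 2, |H_Y^{(k)}(u)| ≤ c(N)·(Y|u|)^{−N}, with constants independent of Y and u. -/

import Mathlib

open MeasureTheory
open scoped FourierTransform

/-- The kernel: even, band-limited, total mass one, all higher moments vanish. -/
lemma exists_kernel : ∃ φ : SchwartzMap ℝ ℝ, (∀ u, φ (-u) = φ u) ∧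
    (∀ x : ℝ, 1 ≤ |x| → 𝓕 (fun u : ℝ => ((φ u : ℝ) : ℂ)) x = 0) ∧
    (∫ v, φ v = 1) ∧ (∀ j : ℕ, 1 ≤ j → ∫ v, v ^ j * φ v = 0) := by
  let b : ContDiffBump (0 : ℝ) := ⟨1/4, 1/2, by norm_num, by norm_num⟩
  have hbs : HasCompactSupport (fun x => ((b x : ℝ) : ℂ)) :=
    b.hasCompactSupport.comp_left (g := fun x : ℝ => (x : ℂ)) (by simp)
  have hbc : ContDiff ℝ (⊤ : ℕ∞) (fun x => ((b x : ℝ) : ℂ)) :=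
    Complex.ofRealCLM.contDiff.comp b.contDiff
  let B : SchwartzMap ℝ ℂ := hbs.toSchwartzMap hbc
  have hB : ∀ x, B x = b x := fun x => rfl
  let ψ : SchwartzMap ℝ ℂ := 𝓕⁻ B
  have hψ : ∀ x, ψ x = ∫ v : ℝ, Complex.exp (2 * Real.pi * (v : ℂ) * (x : ℂ) * Complex.I) * ((b v : ℝ) : ℂ) := by
    intro x
    have : ψ x = 𝓕⁻ (B : ℝ → ℂ) x := by
      rw [← SchwartzMap.fourierInv_coe]
    rw [this, Real.fourierInv_eq']
    apply integral_congr_ae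
    filter_upwards with v
    rw [hB]
    simp [mul_comm, mul_assoc, mul_left_comm]
  have hψneg : ∀ x, ψ (-x) = ψ x := by
    intro x
    rw [hψ, hψ, ← integral_neg_eq_self]
    apply integral_congr_ae
    filter_upwards with v
    simp only [b.neg]
    simp
  have hψconj : ∀ x, (starRingEnd ℂ) (ψ x) = ψ x := by
    intro x
    have h0 : (starRingEnd ℂ) (ψ x) = (starRingEnd ℂ) (ψ (-x)) := by rw [hψneg]
    rw [h0, hψ (-x), hψ x, ← integral_conj]
    apply integral_congr_ae
    filter_upwards with v
    simp [← Complex.exp_conj, map_ofNat (starRingEnd ℂ) 2]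
  let φ : SchwartzMap ℝ ℝ := SchwartzMap.postcompCLM (𝕜 := ℝ) Complex.reCLM ψ
  have hφ : ∀ x, φ x = (ψ x).re := fun x => rfl
  have hφψ : (fun u : ℝ => ((φ u : ℝ) : ℂ)) = ψ := by
    ext x
    rw [hφ]
    exact Complex.conj_eq_iff_re.1 (hψconj x)
  have hF : 𝓕 (fun u : ℝ => ((φ u : ℝ) : ℂ)) = fun x => ((b x : ℝ) : ℂ) := by
    rw [hφψ, ← SchwartzMap.fourier_coe]
    have : 𝓕 ψ = B := FourierTransform.fourier_fourierInv_eq B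
    rw [this]
    rfl
  have hint : ∀ n : ℕ, Integrable (fun x : ℝ => x ^ n • ((φ x : ℝ) : ℂ)) := by
    intro n
    rw [← integrable_norm_iff]
    · refine (φ.integrable_pow_mul volume n).congr ?_
      filter_upwards with x
      simp
    · exact Continuous.aestronglyMeasurable (by have := φ.continuous; fun_prop)
  have key : ∀ j : ℕ, iteratedDeriv j (fun x => ((b x : ℝ) : ℂ)) 0
      = (-2 * Real.pi * Complex.I) ^ j * ((∫ v, v ^ j * φ v : ℝ) : ℂ) := by
    intro j
    rw [← hF, Real.iteratedDeriv_fourier (N := ⊤) (fun n _ => hint n) le_top,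
      Real.fourier_eq', ← integral_complex_ofReal, ← integral_const_mul]
    apply integral_congr_ae
    filter_upwards with v
    simp
    ring
  have hev : (fun x => ((b x : ℝ) : ℂ)) =ᶠ[nhds 0] fun _ => (1 : ℂ) := by
    filter_upwards [b.eventuallyEq_one] with x hx
    simp [hx]
  refine ⟨φ, ?_, ?_, ?_, ?_⟩
  · intro u
    rw [hφ, hφ, hψneg]
  · intro x hx
    rw [hF]
    simp only [Complex.ofReal_eq_zero]
    apply b.zero_of_le_dist
    simp only [dist_zero_right, Real.norm_eq_abs, b]
    linarith
  · have := key 0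
    rw [hev.iteratedDeriv_eq] at this
    simp at this
    exact_mod_cast this.symm
  · intro j hj
    have := key j
    rw [hev.iteratedDeriv_eq, iteratedDeriv_const, if_neg (by omega)] at this
    have h2 := mul_eq_zero.1 this.symm
    rcases h2 with h2 | h2
    · exfalso
      have := pow_eq_zero_iff (by omega) |>.1 h2
      simp [Real.pi_ne_zero] at this
    · exact_mod_cast h2

/-- Convolution of a compactly supported continuous function with a band-limited Schwartz
function is a band-limited Schwartz function. -/
lemma exists_schwartz_convolution (F : ℝ → ℝ) (hF : Continuous F) (hFs : HasCompactSupport F)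
    (g : SchwartzMap ℝ ℝ) (Y : ℝ)
    (hg : ∀ x : ℝ, Y ≤ |x| → 𝓕 (fun u : ℝ => ((g u : ℝ) : ℂ)) x = 0) :
    ∃ H : SchwartzMap ℝ ℝ,
      (∀ u, H u = ∫ t, F t * g (u - t)) ∧
      (∀ x : ℝ, Y ≤ |x| → 𝓕 (fun u : ℝ => ((H u : ℝ) : ℂ)) x = 0) := by
  let Fc : ℝ → ℂ := fun u => ((F u : ℝ) : ℂ)
  let gc : SchwartzMap ℝ ℂ := SchwartzMap.postcompCLM (𝕜 := ℝ) Complex.ofRealCLM g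
  have hgc : (gc : ℝ → ℂ) = fun u => ((g u : ℝ) : ℂ) := rfl
  have hFc : Continuous Fc := by fun_prop
  have hFcs : HasCompactSupport Fc :=
    hFs.comp_left (g := fun x : ℝ => (x : ℂ)) (by simp)
  have hFi : Integrable Fc := hFc.integrable_of_hasCompactSupport hFcs
  have hFhat : ContDiff ℝ (⊤ : ℕ∞) (𝓕 Fc) := by
    apply Real.contDiff_fourier
    intro n _
    apply Continuous.integrable_of_hasCompactSupport (by fun_prop)
    exact hFcs.norm.mul_left
  have hghat : ContDiff ℝ (⊤ : ℕ∞) (𝓕 (gc : ℝ → ℂ)) := by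
    rw [← SchwartzMap.fourier_coe]
    exact (𝓕 gc).smooth ⊤
  have hcs : HasCompactSupport (fun x => 𝓕 Fc x * 𝓕 (gc : ℝ → ℂ) x) := by
    apply HasCompactSupport.mul_left
    apply HasCompactSupport.intro (isCompact_Icc (a := -Y) (b := Y))
    intro x hx
    rw [hgc]
    apply hg
    by_contra h
    push Not at h
    rw [abs_lt] at h
    exact hx ⟨h.1.le, h.2.le⟩
  let P : SchwartzMap ℝ ℂ := hcs.toSchwartzMap (hFhat.mul hghat)
  let K : ℝ → ℂ := convolution Fc gc (ContinuousLinearMap.mul ℂ ℂ) volume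
  have hKhat : 𝓕 K = P := by
    ext ξ
    exact Real.fourier_mul_convolution_eq hFi gc.integrable ξ
  have hKc : Continuous K := by
    refine BddAbove.continuous_convolution_right_of_integrable _ ?_ hFi gc.continuous
    exact ⟨SchwartzMap.seminorm ℝ 0 0 gc,
      fun x ⟨y, hy⟩ ↦ hy ▸ SchwartzMap.norm_le_seminorm ℝ gc y⟩
  have hKi : Integrable K := hFi.integrable_convolution _ gc.integrable
  have hinv : 𝓕⁻ (P : ℝ → ℂ) = K := by
    rw [← hKhat]
    exact hKc.fourierInv_fourier_eq hKi (by rw [hKhat]; exact P.integrable)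
  have hKr : ∀ u, K u = ((∫ t, F t * g (u - t) : ℝ) : ℂ) := by
    intro u
    rw [← integral_complex_ofReal]
    simp only [K, convolution, hgc, Fc]
    simp
  refine ⟨SchwartzMap.postcompCLM (𝕜 := ℝ) Complex.reCLM (𝓕⁻ P), ?_, ?_⟩
  · intro u
    change ((𝓕⁻ P : SchwartzMap ℝ ℂ) u).re = _
    rw [SchwartzMap.fourierInv_coe, hinv, hKr, Complex.ofReal_re]
  · intro x hx
    have : (fun u : ℝ => (((SchwartzMap.postcompCLM (𝕜 := ℝ) Complex.reCLM (𝓕⁻ P) : SchwartzMap ℝ ℝ) u : ℝ) : ℂ)) = K := by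
      ext u
      change (((𝓕⁻ P : SchwartzMap ℝ ℂ) u).re : ℂ) = _
      rw [SchwartzMap.fourierInv_coe, hinv, hKr, Complex.ofReal_re]
    rw [this, hKhat]
    change 𝓕 Fc x * 𝓕 (gc : ℝ → ℂ) x = 0
    rw [hgc, hg x hx, mul_zero]

lemma hasDerivAt_max_pow (n : ℕ) (x : ℝ) :
    HasDerivAt (fun x : ℝ => (max x 0) ^ (n + 2)) ((n + 2) * (max x 0) ^ (n + 1)) x := by
  have hpow : ∀ x : ℝ, HasDerivAt (fun x : ℝ => x ^ (n + 2)) ((n + 2) * x ^ (n + 1)) x := by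
    intro x
    simpa using hasDerivAt_pow (n + 2) x
  rcases lt_trichotomy x 0 with hx | hx | hx
  · rw [max_eq_right hx.le]
    have : HasDerivAt (fun _ : ℝ => (0 : ℝ)) ((n + 2) * (0 : ℝ) ^ (n + 1)) x := by
      simpa using hasDerivAt_const x (0 : ℝ)
    refine this.congr_of_eventuallyEq ?_
    filter_upwards [Iio_mem_nhds hx] with y hy
    rw [max_eq_right (le_of_lt hy)]
    simp
  · subst hx
    have h1 : HasDerivWithinAt (fun x : ℝ => (max x 0) ^ (n + 2))
        ((n + 2) * (max (0 : ℝ) 0) ^ (n + 1)) (Set.Iic 0) 0 := by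
      have : HasDerivWithinAt (fun _ : ℝ => (0 : ℝ))
          ((n + 2) * (max (0 : ℝ) 0) ^ (n + 1)) (Set.Iic 0) 0 := by
        simpa using hasDerivWithinAt_const (0 : ℝ) (Set.Iic 0) (0 : ℝ)
      refine this.congr ?_ (by simp)
      intro y hy
      rw [max_eq_right hy]
      simp
    have h2 : HasDerivWithinAt (fun x : ℝ => (max x 0) ^ (n + 2))
        ((n + 2) * (max (0 : ℝ) 0) ^ (n + 1)) (Set.Ici 0) 0 := by
      rw [max_self]
      refine (hpow 0).hasDerivWithinAt.congr ?_ (by simp)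
      intro y hy
      rw [max_eq_left hy]
    have := h1.union h2
    rw [Set.Iic_union_Ici] at this
    exact this.hasDerivAt Filter.univ_mem
  · rw [max_eq_left hx.le]
    refine (hpow x).congr_of_eventuallyEq ?_
    filter_upwards [Ioi_mem_nhds hx] with y hy
    rw [max_eq_left (le_of_lt hy)]

lemma hasDerivAt_poly_mul (q : Polynomial ℝ) (n : ℕ) (u : ℝ) :
    HasDerivAt (fun u : ℝ => q.eval u * (max (1 - u ^ 2) 0) ^ (n + 2))
      ((Polynomial.derivative q * (1 - Polynomial.X ^ 2)
        - Polynomial.C (2 * ((n : ℝ) + 2)) * Polynomial.X * q).eval u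
        * (max (1 - u ^ 2) 0) ^ (n + 1)) u := by
  have h1 : HasDerivAt (fun u : ℝ => 1 - u ^ 2) (-(2 * u)) u := by
    simpa using (hasDerivAt_pow 2 u).const_sub 1
  have h2 := (hasDerivAt_max_pow n (1 - u ^ 2)).comp u h1
  have h3 := (q.hasDerivAt u).mul h2
  refine h3.congr_deriv ?_
  have h4 : (max (1 - u ^ 2) 0) ^ (n + 2) = (1 - u ^ 2) * (max (1 - u ^ 2) 0) ^ (n + 1) := by
    rcases le_total (1 - u ^ 2) 0 with h | h
    · simp [max_eq_right h]
    · rw [max_eq_left h]; ring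
  simp only [Function.comp]
  rw [h4]
  simp
  ring

lemma iteratedDeriv_F (S : ℕ) (k : ℕ) (hk : k + 1 ≤ S) :
    ∃ q : Polynomial ℝ, iteratedDeriv k (fun u : ℝ => (max (1 - u ^ 2) 0 : ℝ) ^ S)
      = fun u => q.eval u * (max (1 - u ^ 2) 0) ^ (S - k) := by
  induction k with
  | zero => exact ⟨1, by ext u; simp⟩
  | succ k ih =>
    obtain ⟨q, hq⟩ := ih (by omega)
    obtain ⟨n, rfl⟩ : ∃ n, S = k + n + 2 := ⟨S - k - 2, by omega⟩
    have e1 : k + n + 2 - k = n + 2 := by omega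
    have e2 : k + n + 2 - (k + 1) = n + 1 := by omega
    rw [e1] at hq
    rw [iteratedDeriv_succ, hq, e2]
    exact ⟨_, funext fun u => (hasDerivAt_poly_mul q n u).deriv⟩

lemma F_facts (S : ℕ) (hS : 1 ≤ S) (D : ℕ → ℝ → ℝ)
    (hD : D = fun k => iteratedDeriv k (fun u : ℝ => (max (1 - u ^ 2) 0 : ℝ) ^ S)) :
    (∀ k, k ≤ S - 1 → Continuous (D k)) ∧
    (∀ k, k < S - 1 → ∀ u, HasDerivAt (D k) (D (k + 1) u) u) ∧
    (∀ k, k ≤ S - 1 → ∀ u, 1 ≤ |u| → D k u = 0) ∧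
    (∃ L, 0 ≤ L ∧ ∀ u v, |D (S - 1) u - D (S - 1) v| ≤ L * |u - v|) := by
  subst hD
  refine ⟨?_, ?_, ?_, ?_⟩
  · intro k hk
    obtain ⟨q, hq⟩ := iteratedDeriv_F S k (by omega)
    simp only [hq]
    have := q.continuous
    fun_prop
  · intro k hk u
    obtain ⟨q, hq⟩ := iteratedDeriv_F S k (by omega)
    simp only [iteratedDeriv_succ]
    refine DifferentiableAt.hasDerivAt ?_
    rw [hq]
    obtain ⟨n, rfl⟩ : ∃ n, S = k + n + 2 := ⟨S - k - 2, by omega⟩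
    have e1 : k + n + 2 - k = n + 2 := by omega
    rw [e1]
    exact (hasDerivAt_poly_mul q n u).differentiableAt
  · intro k hk u hu
    obtain ⟨q, hq⟩ := iteratedDeriv_F S k (by omega)
    simp only [hq]
    have : 1 - u ^ 2 ≤ 0 := by
      have := one_le_pow₀ hu (n := 2)
      rw [sq_abs] at this
      linarith
    rw [max_eq_right this, zero_pow (by omega), mul_zero]
  · obtain ⟨q, hq⟩ := iteratedDeriv_F S (S - 1) (by omega)
    have e : S - (S - 1) = 1 := by omega
    rw [e] at hq
    simp only [hq, pow_one]
    let Q : Polynomial ℝ := q * (1 - Polynomial.X ^ 2)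
    obtain ⟨L, hL⟩ := (isCompact_Icc (a := (-1 : ℝ)) (b := 1)).exists_bound_of_continuousOn
      (f := fun x => (Polynomial.derivative Q).eval x) (Polynomial.continuous _).continuousOn
    have hL0 : 0 ≤ L := (norm_nonneg _).trans (hL 0 (by simp))
    have hQ : ∀ u, q.eval u * max (1 - u ^ 2) 0 = Q.eval (max (-1) (min u 1)) := by
      intro u
      rcases le_total u (-1) with h | h
      · rw [min_eq_left (by linarith), max_eq_left h, max_eq_right (by nlinarith)]
        simp [Q]
      · rcases le_total u 1 with h' | h'
        · rw [min_eq_left h', max_eq_right h, max_eq_left (by nlinarith)]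
          simp [Q]
        · rw [min_eq_right h', max_eq_right (a := (-1 : ℝ)) (b := 1) (by norm_num),
            max_eq_right (by nlinarith)]
          simp [Q]
    refine ⟨L, hL0, fun u v => ?_⟩
    rw [hQ, hQ]
    have hmem : ∀ u : ℝ, max (-1) (min u 1) ∈ Set.Icc (-1 : ℝ) 1 := fun u =>
      ⟨le_max_left _ _, max_le (by norm_num) (min_le_right _ _)⟩
    have := (convex_Icc (-1 : ℝ) 1).norm_image_sub_le_of_norm_hasDerivWithin_le
      (f := fun x => Q.eval x) (f' := fun x => (Polynomial.derivative Q).eval x)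
      (fun x _ => (Q.hasDerivAt x).hasDerivWithinAt) hL (hmem v) (hmem u)
    refine this.trans (mul_le_mul_of_nonneg_left ?_ hL0)
    rw [Real.norm_eq_abs]
    refine (abs_max_sub_max_le_max _ _ _ _).trans ?_
    rw [sub_self, abs_zero, max_eq_right (abs_nonneg _)]
    refine (abs_min_sub_min_le_max _ _ _ _).trans ?_
    rw [sub_self, abs_zero, max_eq_left (abs_nonneg _)]

lemma taylor_lip (L : ℝ) (hL : 0 ≤ L) (m : ℕ) : ∀ g : ℕ → ℝ → ℝ,
    (∀ i, i < m → ∀ u, HasDerivAt (g i) (g (i + 1) u) u) →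
    (∀ u v, |g m u - g m v| ≤ L * |u - v|) → ∀ u w,
    |g 0 (u + w) - ∑ j ∈ Finset.range (m + 1), g j u / (j.factorial : ℝ) * w ^ j|
      ≤ L * |w| ^ (m + 1) := by
  induction m with
  | zero =>
    intro g _ h u w
    simpa using h (u + w) u
  | succ m ih =>
    intro g hg h u w
    have ih' := ih (fun i => g (i + 1)) (fun i hi => hg (i + 1) (by omega)) h u
    let R : ℝ → ℝ := fun t =>
      g 0 (u + t) - ∑ j ∈ Finset.range (m + 1 + 1), g j u / (j.factorial : ℝ) * t ^ j
    let R' : ℝ → ℝ := fun t =>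
      g 1 (u + t) - ∑ j ∈ Finset.range (m + 1), g (j + 1) u / (j.factorial : ℝ) * t ^ j
    have hR : ∀ t, HasDerivAt R (R' t) t := by
      intro t
      have h1 : HasDerivAt (fun t => g 0 (u + t)) (g 1 (u + t)) t :=
        (hg 0 (by omega) (u + t)).comp_const_add u t
      have h2 : HasDerivAt
          (fun t : ℝ => ∑ j ∈ Finset.range (m + 1 + 1), g j u / (j.factorial : ℝ) * t ^ j)
          (∑ j ∈ Finset.range (m + 1 + 1), g j u / (j.factorial : ℝ) * (j * t ^ (j - 1))) t :=
        HasDerivAt.fun_sum fun j _ => (hasDerivAt_pow j t).const_mul _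
      refine (h1.sub h2).congr_deriv ?_
      simp only [R']
      rw [Finset.sum_range_succ' _ (m + 1)]
      simp only [Nat.cast_zero, zero_mul, mul_zero, add_zero]
      congr 1
      apply Finset.sum_congr rfl
      intro j _
      have : ((j.factorial : ℕ) : ℝ) ≠ 0 := by positivity
      rw [Nat.factorial_succ]
      push_cast
      field_simp
    have hR0 : R 0 = 0 := by
      simp only [R]
      rw [Finset.sum_range_succ']
      simp
    have := (convex_uIcc (0 : ℝ) w).norm_image_sub_le_of_norm_hasDerivWithin_le
      (f := R) (f' := R') (C := L * |w| ^ (m + 1))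
      (fun x _ => (hR x).hasDerivWithinAt) (fun x hx => by
        refine (ih' x).trans ?_
        have : |x| ≤ |w| := by simpa using Set.abs_sub_left_of_mem_uIcc hx
        gcongr) Set.left_mem_uIcc Set.right_mem_uIcc
    rw [hR0, sub_zero, sub_zero, Real.norm_eq_abs, Real.norm_eq_abs] at this
    refine this.trans (le_of_eq (by ring))

lemma error_bound (φ : SchwartzMap ℝ ℝ) (h0 : ∫ v, φ v = 1)
    (hm : ∀ j : ℕ, 1 ≤ j → ∫ v, v ^ j * φ v = 0) (f : ℝ → ℝ) (hf : Continuous f) (M : ℝ)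
    (hM : ∀ u, |f u| ≤ M) (L Y u : ℝ) (hY : 0 < Y) (m : ℕ) (a : ℕ → ℝ) (ha : a 0 = f u)
    (hT : ∀ w, |f (u + w) - ∑ j ∈ Finset.range (m + 1), a j * w ^ j| ≤ L * |w| ^ (m + 1)) :
    |f u - ∫ v, f (u - v / Y) * φ v|
      ≤ L * (∫ v, |v| ^ (m + 1) * |φ v|) * (Y ^ (m + 1))⁻¹ := by
  have hint : ∀ n : ℕ, Integrable (fun x : ℝ => x ^ n * φ x) := by
    intro n
    rw [← integrable_norm_iff]
    · refine (φ.integrable_pow_mul volume n).congr ?_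
      filter_upwards with x
      simp
    · exact Continuous.aestronglyMeasurable (by have := φ.continuous; fun_prop)
  have habs : Integrable (fun v : ℝ => |v| ^ (m + 1) * |φ v|) :=
    φ.integrable_pow_mul volume (m + 1)
  have hfi : Integrable (fun v => f (u - v / Y) * φ v) := by
    refine φ.integrable.bdd_mul (c := M) (Continuous.aestronglyMeasurable (by fun_prop)) ?_
    filter_upwards with v
    exact hM _
  have hji : ∀ j, Integrable (fun v : ℝ => a j * (-(v / Y)) ^ j * φ v) := by
    intro j
    refine ((hint j).const_mul (a j * (-(1 / Y)) ^ j)).congr ?_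
    filter_upwards with v
    have : -(v / Y) = -(1 / Y) * v := by ring
    rw [this, mul_pow]; ring
  have hsi : Integrable
      (fun v : ℝ => (∑ j ∈ Finset.range (m + 1), a j * (-(v / Y)) ^ j) * φ v) := by
    simp only [Finset.sum_mul]
    exact integrable_finsetSum _ fun j _ => hji j
  have hs : ∫ v : ℝ, (∑ j ∈ Finset.range (m + 1), a j * (-(v / Y)) ^ j) * φ v = f u := by
    simp only [Finset.sum_mul]
    rw [integral_finsetSum _ fun j _ => hji j, Finset.sum_range_succ']
    have : ∀ j : ℕ, ∫ v : ℝ, a (j + 1) * (-(v / Y)) ^ (j + 1) * φ v = 0 := by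
      intro j
      have e : ∀ v : ℝ, a (j + 1) * (-(v / Y)) ^ (j + 1) * φ v
          = a (j + 1) * (-(1 / Y)) ^ (j + 1) * (v ^ (j + 1) * φ v) := by
        intro v
        have : -(v / Y) = -(1 / Y) * v := by ring
        rw [this, mul_pow]; ring
      simp only [e]
      rw [integral_const_mul, hm _ (by omega), mul_zero]
    rw [Finset.sum_eq_zero fun j _ => this j]
    simp only [pow_zero, mul_one, zero_add]
    rw [integral_const_mul, h0, ha, mul_one]
  rw [← hs, ← integral_sub hsi hfi, ← Real.norm_eq_abs]
  have hb : Integrable (fun v : ℝ => L * (Y ^ (m + 1))⁻¹ * (|v| ^ (m + 1) * |φ v|)) :=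
    habs.const_mul _
  refine (norm_integral_le_of_norm_le hb ?_).trans (le_of_eq ?_)
  · filter_upwards with v
    rw [← sub_mul, norm_mul, Real.norm_eq_abs, Real.norm_eq_abs, abs_sub_comm, ← mul_assoc]
    refine mul_le_mul_of_nonneg_right ?_ (abs_nonneg _)
    have := hT (-(v / Y))
    rw [← sub_eq_add_neg, abs_neg, abs_div, abs_of_pos hY, div_pow] at this
    refine this.trans (le_of_eq (by rw [div_eq_mul_inv]; ring))
  · rw [integral_const_mul]; ring

lemma iteratedDeriv_conv (n : ℕ) (D : ℕ → ℝ → ℝ) (g H : ℝ → ℝ) (hg : Continuous g)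
    (hc : ∀ k, k ≤ n → Continuous (D k))
    (hd : ∀ k, k < n → ∀ u, HasDerivAt (D k) (D (k + 1) u) u)
    (hz : ∀ k, k ≤ n → ∀ u, 1 ≤ |u| → D k u = 0)
    (hH : ∀ u, H u = ∫ t, D 0 t * g (u - t)) (k : ℕ) (hk : k ≤ n) :
    iteratedDeriv k H = fun u => ∫ t, D k t * g (u - t) := by
  induction k with
  | zero => ext u; simp [hH]
  | succ k ih =>
    rw [iteratedDeriv_succ, ih (by omega)]
    have hder : deriv (D k) = D (k + 1) := funext fun u => (hd k (by omega) u).deriv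
    have hcs : HasCompactSupport (D k) := by
      apply HasCompactSupport.intro (isCompact_Icc (a := (-1 : ℝ)) (b := 1))
      intro x hx
      apply hz k (by omega)
      by_contra h
      push Not at h
      rw [abs_lt] at h
      exact hx ⟨h.1.le, h.2.le⟩
    have hC1 : ContDiff ℝ 1 (D k) := by
      rw [contDiff_one_iff_deriv, hder]
      exact ⟨fun u => (hd k (by omega) u).differentiableAt, hc _ hk⟩
    ext u
    have := hcs.hasDerivAt_convolution_left (μ := volume) (ContinuousLinearMap.mul ℝ ℝ) hC1
      hg.locallyIntegrable u
    rw [hder] at this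
    exact this.deriv

lemma decay_bound (f : ℝ → ℝ) (M : ℝ) (hM : ∀ u, |f u| ≤ M)
    (hz : ∀ u, 1 ≤ |u| → f u = 0) (g : ℝ → ℝ) (A : ℝ) (N : ℕ)
    (hA : ∀ x, |x| ^ (N + 1) * |g x| ≤ A) (Y u : ℝ) (hY : 1 < Y) (hu : 2 ≤ |u|) :
    |∫ t, f t * (Y * g (Y * (u - t)))| ≤ 2 * M * A * 2 ^ (N + 1) * ((Y * |u|) ^ N)⁻¹ := by
  have hM0 : 0 ≤ M := (abs_nonneg _).trans (hM 0)
  have hA0 : 0 ≤ A := le_trans (by positivity) (hA 0)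
  have hY0 : 0 < Y := by linarith
  have hu0 : 0 < |u| := by linarith
  rw [← setIntegral_eq_integral_of_forall_compl_eq_zero (s := Set.Icc (-1) 1)]
  · have := norm_setIntegral_le_of_norm_le_const (μ := volume) (s := Set.Icc (-1 : ℝ) 1)
      (f := fun t => f t * (Y * g (Y * (u - t))))
      (C := M * A * 2 ^ (N + 1) * ((Y * |u|) ^ N)⁻¹) (by simp) (by
        intro t ht
        have ht1 : |t| ≤ 1 := abs_le.2 ht
        have hut : |u| / 2 ≤ |u - t| := by
          have := abs_sub_abs_le_abs_sub u t
          linarith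
        rw [norm_mul, norm_mul, Real.norm_eq_abs, Real.norm_eq_abs, Real.norm_eq_abs,
          abs_of_pos hY0]
        have h1 : (Y * |u| / 2) ^ (N + 1) * |g (Y * (u - t))| ≤ A := by
          refine le_trans ?_ (hA (Y * (u - t)))
          refine mul_le_mul_of_nonneg_right ?_ (abs_nonneg _)
          apply pow_le_pow_left₀ (by positivity)
          rw [abs_mul, abs_of_pos hY0, mul_div_assoc]
          gcongr
        have h2 : Y * |g (Y * (u - t))| ≤ A * 2 ^ (N + 1) * ((Y * |u|) ^ N)⁻¹ := by
          rw [← div_eq_mul_inv, le_div_iff₀ (by positivity)]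
          rw [div_pow, div_mul_eq_mul_div, div_le_iff₀ (by positivity)] at h1
          refine le_trans ?_ h1
          rw [pow_succ]
          have : Y ≤ Y * |u| := by nlinarith
          calc Y * |g (Y * (u - t))| * (Y * |u|) ^ N
              = (Y * |u|) ^ N * Y * |g (Y * (u - t))| := by ring
            _ ≤ _ := by gcongr
        calc |f t| * (Y * |g (Y * (u - t))|) ≤ M * (A * 2 ^ (N + 1) * ((Y * |u|) ^ N)⁻¹) :=
              mul_le_mul (hM t) h2 (by positivity) hM0
          _ = _ := by ring)
    rw [Real.norm_eq_abs] at this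
    refine this.trans (le_of_eq ?_)
    rw [Real.volume_real_Icc_of_le (by norm_num)]
    ring
  · intro t ht
    rw [hz t, zero_mul]
    by_contra h
    push Not at h
    rw [abs_lt] at h
    exact ht ⟨h.1.le, h.2.le⟩

lemma exists_scaled (φ : SchwartzMap ℝ ℝ)
    (hφ : ∀ x : ℝ, 1 ≤ |x| → 𝓕 (fun u : ℝ => ((φ u : ℝ) : ℂ)) x = 0) (Y : ℝ) (hY : 0 < Y) :
    ∃ g : SchwartzMap ℝ ℝ, (∀ u, g u = Y * φ (Y * u)) ∧
      (∀ x : ℝ, Y ≤ |x| → 𝓕 (fun u : ℝ => ((g u : ℝ) : ℂ)) x = 0) := by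
  let e : ℝ ≃L[ℝ] ℝ := ContinuousLinearEquiv.unitsEquivAut ℝ (Units.mk0 Y hY.ne')
  let g : SchwartzMap ℝ ℝ := Y • SchwartzMap.compCLMOfContinuousLinearEquiv ℝ e φ
  have hg : ∀ u, g u = Y * φ (Y * u) := by
    intro u
    change Y * φ (u * Y) = _
    rw [mul_comm u]
  refine ⟨g, hg, ?_⟩
  intro x hx
  have h1 : 1 ≤ |x / Y| := by
    rw [abs_div, abs_of_pos hY, le_div_iff₀ hY]; linarith
  have h2 := hφ _ h1
  rw [Real.fourier_eq'] at h2 ⊢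
  have := Measure.integral_comp_mul_left
    (fun v : ℝ => Complex.exp (((-2 * Real.pi * inner ℝ v (x / Y) : ℝ) : ℂ) * Complex.I) •
      ((φ v : ℝ) : ℂ)) Y
  rw [h2, smul_zero] at this
  have h3 : ∀ v : ℝ, Complex.exp (((-2 * Real.pi * inner ℝ v x : ℝ) : ℂ) * Complex.I) •
      ((g v : ℝ) : ℂ) = (Y : ℂ) *
      (Complex.exp (((-2 * Real.pi * inner ℝ (Y * v) (x / Y) : ℝ) : ℂ) * Complex.I) •
      ((φ (Y * v) : ℝ) : ℂ)) := by
    intro v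
    have : (inner ℝ (Y * v) (x / Y) : ℝ) = inner ℝ v x := by
      simp
      field_simp
    rw [this, hg]
    simp only [smul_eq_mul]
    push_cast
    ring
  simp only [h3]
  rw [integral_const_mul, this, mul_zero]


/-- Lemma (bandlimitapproxlemma): for `F(u) = (1−u²)₊^S` and every `Y > 1` there is an even
Schwartz function `H_Y` whose Fourier transform vanishes for `|x| ≥ Y`, approximating `F`
and its derivatives at rate `Y^{k−S}`, and rapidly decaying for `|u| ≥ 2`, with constants
independent of `Y` and `u`. -/
theorem bandlimited_approximation (S : ℕ) (hS : 2 ≤ S) :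
    ∃ c > 0, ∃ C : ℕ → ℝ,
      ∀ Y : ℝ, 1 < Y →
        ∃ HY : SchwartzMap ℝ ℝ,
          (∀ u : ℝ, HY (-u) = HY u) ∧
          (∀ x : ℝ, Y ≤ |x| → 𝓕 (fun u : ℝ => ((HY u : ℝ) : ℂ)) x = 0) ∧
          (∀ k : ℕ, k ≤ S - 1 → ∀ u : ℝ,
            |iteratedDeriv k (fun u : ℝ => (max (1 - u ^ 2) 0 : ℝ) ^ S) u
                - iteratedDeriv k (⇑HY) u| ≤ c * Y ^ ((k : ℝ) - S)) ∧
          (∀ N : ℕ, 1 ≤ N → 0 < C N ∧ ∀ k : ℕ, k ≤ S - 1 → ∀ u : ℝ, 2 ≤ |u| →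
            |iteratedDeriv k (⇑HY) u| ≤ C N * (Y * |u|) ^ (-(N : ℝ))) := by

  obtain ⟨φ, hφe, hφb, hφ0, hφm⟩ := exists_kernel
  obtain ⟨D, hD⟩ : ∃ D : ℕ → ℝ → ℝ,
    D = fun k => iteratedDeriv k (fun u : ℝ => (max (1 - u ^ 2) 0 : ℝ) ^ S) := ⟨_, rfl⟩
  obtain ⟨hDc, hDd, hDz, L, hL0, hL⟩ := F_facts S (by omega) D hD
  have hD0 : D 0 = fun u : ℝ => (max (1 - u ^ 2) 0 : ℝ) ^ S := by
    rw [hD]; simp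
  have hcs : ∀ k, k ≤ S - 1 → HasCompactSupport (D k) := by
    intro k hk
    apply HasCompactSupport.intro (isCompact_Icc (a := (-1 : ℝ)) (b := 1))
    intro x hx
    apply hDz k hk
    by_contra h
    push Not at h
    rw [abs_lt] at h
    exact hx ⟨h.1.le, h.2.le⟩
  have hMex : ∀ k, ∃ M, 0 ≤ M ∧ (k ≤ S - 1 → ∀ u, |D k u| ≤ M) := by
    intro k
    by_cases hk : k ≤ S - 1
    · obtain ⟨M, hM⟩ := (hcs k hk).exists_bound_of_continuous (hDc k hk)
      exact ⟨M, (norm_nonneg _).trans (hM 0), fun _ => hM⟩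
    · exact ⟨0, le_rfl, fun h => absurd h hk⟩
  choose M hM0 hM using hMex
  have hAex : ∀ N : ℕ, ∃ A, 0 < A ∧ ∀ x, |x| ^ (N + 1) * |φ x| ≤ A := by
    intro N
    obtain ⟨A, hA, h⟩ := φ.decay (N + 1) 0
    exact ⟨A, hA, fun x => by simpa using h x⟩
  choose A hA0 hA using hAex
  let I : ℕ → ℝ := fun i => ∫ v, |v| ^ i * |φ v|
  have hI : ∀ i, 0 ≤ I i := fun i => integral_nonneg fun v => by positivity
  let MM : ℝ := ∑ k ∈ Finset.range S, M k
  have hMM : ∀ k, k ≤ S - 1 → M k ≤ MM := fun k hk =>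
    Finset.single_le_sum (f := M) (fun i _ => hM0 i) (Finset.mem_range.2 (by omega))
  have hMM0 : 0 ≤ MM := Finset.sum_nonneg fun i _ => hM0 i
  have hII0 : 0 ≤ ∑ i ∈ Finset.range (S + 1), I i := Finset.sum_nonneg fun i _ => hI i
  refine ⟨1 + L * ∑ i ∈ Finset.range (S + 1), I i, by positivity,
    fun N => 1 + 2 * MM * A N * 2 ^ (N + 1), ?_⟩
  intro Y hY
  have hY0 : 0 < Y := by linarith
  obtain ⟨g, hg, hgb⟩ := exists_scaled φ hφb Y hY0
  obtain ⟨H, hH, hHb⟩ := exists_schwartz_convolution (D 0) (hDc 0 (by omega))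
    (hcs 0 (by omega)) g Y hgb
  have hit := iteratedDeriv_conv (S - 1) D g H g.continuous hDc hDd hDz hH
  refine ⟨H, ?_, hHb, ?_, ?_⟩
  · intro u
    rw [hH, hH, ← integral_neg_eq_self]
    apply integral_congr_ae
    filter_upwards with t
    have e1 : D 0 (-t) = D 0 t := by rw [hD0]; simp
    have e2 : g (-u - -t) = g (u - t) := by
      rw [hg, hg, ← hφe]
      congr 2
      ring
    simp only [e1, e2]
  · intro k hk u
    have hk' : iteratedDeriv k (fun u : ℝ => (max (1 - u ^ 2) 0 : ℝ) ^ S) = D k := by rw [hD]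
    rw [hk', hit k hk]
    have hsub : ∫ t, D k t * g (u - t) = ∫ v, D k (u - v / Y) * φ v := by
      rw [← integral_sub_left_eq_self (fun t => D k t * g (u - t)) volume u]
      have := Measure.integral_comp_mul_left (fun v : ℝ => D k (u - v / Y) * φ v) Y
      have h3 : ∀ t : ℝ, D k (u - t) * g (u - (u - t))
          = Y * (D k (u - Y * t / Y) * φ (Y * t)) := by
        intro t
        rw [hg, mul_div_cancel_left₀ _ hY0.ne', sub_sub_cancel]
        ring
      simp only [h3]
      rw [integral_const_mul, this, abs_of_pos (by positivity), smul_eq_mul,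
        mul_inv_cancel_left₀ hY0.ne']
    simp only [hsub]
    obtain ⟨m, hm⟩ : ∃ m, S = k + m + 1 := ⟨S - 1 - k, by omega⟩
    have hT := taylor_lip L hL0 m (fun i => D (k + i)) (fun i hi v => hDd (k + i) (by omega) v)
      (by
        have : k + m = S - 1 := by omega
        simpa only [this] using hL) u
    have := error_bound φ hφ0 hφm (D k) (hDc k hk) (M k) (hM k hk) L Y u hY0 m
      (fun j => D (k + j) u / (j.factorial : ℝ)) (by simp) hT
    refine this.trans ?_
    have e : Y ^ ((k : ℝ) - S) = (Y ^ (m + 1))⁻¹ := by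
      rw [hm, ← Real.rpow_natCast, ← Real.rpow_neg hY0.le]
      congr 1
      push_cast
      ring
    rw [e]
    refine mul_le_mul_of_nonneg_right ?_ (by positivity)
    have hIle : I (m + 1) ≤ ∑ i ∈ Finset.range (S + 1), I i :=
      Finset.single_le_sum (f := I) (fun i _ => hI i) (Finset.mem_range.2 (by omega))
    have := mul_le_mul_of_nonneg_left hIle hL0
    simp only [I] at this ⊢
    linarith
  · intro N hN
    have hAN := (hA0 N).le
    refine ⟨by positivity, ?_⟩
    intro k hk u hu
    rw [hit k hk]
    simp only [hg]
    have := decay_bound (D k) MM (fun u => (hM k hk u).trans (hMM k hk)) (hDz k hk) φ (A N) N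
      (hA N) Y u hY hu
    refine this.trans ?_
    rw [Real.rpow_neg (by positivity), Real.rpow_natCast]
    refine mul_le_mul_of_nonneg_right ?_ (by positivity)
    linarith
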